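/- Fix N ≥ 1 and consider a periodic qubit chain of length 2N+3 with H' = Σᵢ h'_{i,i+1,i+2} (indices mod 2N+3), where h' = I - |000⟩⟨000| - |111⟩⟨111| - |0+1⟩⟨0+1| - |1+0⟩⟨1+0|. Let |φ_N⟩ = Σ_{i,j} |ψ_{i,j}⟩, summing over N² basis states ψ_{i,j} consisting of a block of ones between positions i and j surrounded by zeros (domain walls varying over windows of size N each, with the two walls separated by at least one site from the boundary terms). Then ⟨φ_N|φ_N⟩ = N², |φ_N⟩ is orthogonal to |0⋯0⟩ and |1⋯1⟩, and ⟨φ_N| H' |φ_N⟩ ≤ C·N for a constant C independent of N. Consequently, H' has a nonzero eigenvalue λ_N ≤ C/N. -/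

import Mathlib

open Matrix

noncomputable section

def e0 : Fin 2 → ℂ := ![1, 0]
def e1 : Fin 2 → ℂ := ![0, 1]
def ePlus : Fin 2 → ℂ := ![1 / (Real.sqrt 2 : ℂ), 1 / (Real.sqrt 2 : ℂ)]

def ket3 (x y z : Fin 2 → ℂ) : Fin 2 × Fin 2 × Fin 2 → ℂ :=
  fun p => x p.1 * y p.2.1 * z p.2.2

def proj (v : Fin 2 × Fin 2 × Fin 2 → ℂ) :
    Matrix (Fin 2 × Fin 2 × Fin 2) (Fin 2 × Fin 2 × Fin 2) ℂ :=
  Matrix.vecMulVec v (star v)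

/-- `h' = I - |000⟩⟨000| - |111⟩⟨111| - |0+1⟩⟨0+1| - |1+0⟩⟨1+0|`. -/
def hGHZ : Matrix (Fin 2 × Fin 2 × Fin 2) (Fin 2 × Fin 2 × Fin 2) ℂ :=
  1 - proj (ket3 e0 e0 e0) - proj (ket3 e1 e1 e1)
    - proj (ket3 e0 ePlus e1) - proj (ket3 e1 ePlus e0)

def sitePos {n : ℕ} (hn : 0 < n) (i : ℕ) : Fin n := ⟨i % n, Nat.mod_lt _ hn⟩

/-- `h` acting on sites `i, i+1, i+2` (mod `n`) of a periodic qubit chain. -/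
def embed3 {n : ℕ} (hn : 0 < n)
    (h : Matrix (Fin 2 × Fin 2 × Fin 2) (Fin 2 × Fin 2 × Fin 2) ℂ) (i : ℕ) :
    Matrix (Fin n → Fin 2) (Fin n → Fin 2) ℂ :=
  fun f g =>
    (if ∀ j : Fin n, j ≠ sitePos hn i → j ≠ sitePos hn (i + 1) → j ≠ sitePos hn (i + 2) →
        f j = g j then 1 else 0) *
    h (f (sitePos hn i), f (sitePos hn (i + 1)), f (sitePos hn (i + 2)))
      (g (sitePos hn i), g (sitePos hn (i + 1)), g (sitePos hn (i + 2)))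

def basisState {n : ℕ} (c : Fin n → Fin 2) : (Fin n → Fin 2) → ℂ :=
  fun f => if f = c then 1 else 0

/-- The GHZ uncle Hamiltonian on a periodic chain of `2N+3` qubits. -/
def Huncle (N : ℕ) : Matrix (Fin (2 * N + 3) → Fin 2) (Fin (2 * N + 3) → Fin 2) ℂ :=
  ∑ i ∈ Finset.range (2 * N + 3), embed3 (show 0 < 2 * N + 3 by omega) hGHZ i

/-- The domain-wall configuration with a contiguous block of ones between (shifted, centered)
positions `i` and `j`, zeros elsewhere.  Sites of the chain of length `2N+3` are labeled by
`s = p - (N+1) ∈ {-(N+1), …, N+1}`. -/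
def wallConfig (N : ℕ) (i j : ℤ) : Fin (2 * N + 3) → Fin 2 :=
  fun p => if i ≤ (p : ℤ) - (N + 1) ∧ (p : ℤ) - (N + 1) ≤ j then 1 else 0

/-- `|φ_N⟩ = Σ_{-N ≤ i ≤ -1, 1 ≤ j ≤ N} |ψ_{i,j}⟩`, the sum of `N²` domain-wall basis
states. -/
def phiN (N : ℕ) : (Fin (2 * N + 3) → Fin 2) → ℂ :=
  ∑ i ∈ Finset.Icc (-(N : ℤ)) (-1), ∑ j ∈ Finset.Icc (1 : ℤ) (N : ℤ),
    basisState (wallConfig N i j)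

section

open scoped ComplexOrder

/-- The configuration obtained from `f` by flipping the qubit at site `p`. -/
def flipAt {n : ℕ} (f : Fin n → Fin 2) (p : Fin n) : Fin n → Fin 2 :=
  Function.update f p (1 - f p)

theorem inv_sqrt_two_mul_self :
    ((Real.sqrt 2 : ℂ))⁻¹ * ((Real.sqrt 2 : ℂ))⁻¹ = 1 / 2 := by
  rw [← mul_inv, ← Complex.ofReal_mul, Real.mul_self_sqrt (by norm_num)]
  norm_num

theorem hGHZ_apply (x y z x' y' z' : Fin 2) :
    hGHZ (x, y, z) (x', y', z') =
      if x = x' ∧ z = z' then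
        if x = z then (if y = y' ∧ y ≠ x then 1 else 0)
        else (if y = y' then 1 / 2 else -(1 / 2))
      else 0 := by
  have h2 := inv_sqrt_two_mul_self
  fin_cases x <;> fin_cases y <;> fin_cases z <;> fin_cases x' <;> fin_cases y' <;>
    fin_cases z' <;>
    simp [hGHZ, proj, ket3, e0, e1, ePlus, Matrix.vecMulVec_apply, h2] <;>
    norm_num

theorem fin_two_sub_ne (x : Fin 2) : 1 - x ≠ x := by
  revert x; decide

theorem flipAt_ne {n : ℕ} (f : Fin n → Fin 2) (p : Fin n) : flipAt f p ≠ f := by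
  intro h
  have := congrFun h p
  simp [flipAt, fin_two_sub_ne] at this

theorem flipAt_self {n : ℕ} (f : Fin n → Fin 2) (p : Fin n) : flipAt f p p = 1 - f p := by
  simp [flipAt]

theorem flipAt_of_ne {n : ℕ} (f : Fin n → Fin 2) {p q : Fin n} (h : q ≠ p) :
    flipAt f p q = f q := by
  simp [flipAt, h]

theorem flipAt_flipAt {n : ℕ} (f : Fin n → Fin 2) (p : Fin n) :
    flipAt (flipAt f p) p = f := by
  simp [flipAt]

theorem sitePos_ne {n : ℕ} (hn : 0 < n) {a b : ℕ} (hab : a < b) (hb : b < a + n) :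
    sitePos hn a ≠ sitePos hn b := by
  intro h
  have h1 : a % n = b % n := congrArg Fin.val h
  have h2 : n ∣ b - a := (Nat.modEq_iff_dvd' hab.le).1 h1
  exact absurd (Nat.le_of_dvd (by omega) h2) (by omega)

theorem embed3_hGHZ_apply {n : ℕ} (hn : 0 < n) (h3 : 3 ≤ n) (k : ℕ)
    (f g : Fin n → Fin 2) :
    embed3 hn hGHZ k f g =
      (if g = f then
        (if f (sitePos hn k) = f (sitePos hn (k + 2)) then
          (if f (sitePos hn (k + 1)) = f (sitePos hn k) then 0 else 1) else 1 / 2) else 0) +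
      (if g = flipAt f (sitePos hn (k + 1)) then
        (if f (sitePos hn k) = f (sitePos hn (k + 2)) then 0 else -(1 / 2)) else 0) := by
  have h01 := sitePos_ne hn (show k < k + 1 by omega) (by omega)
  have h02 := sitePos_ne hn (show k < k + 2 by omega) (by omega)
  have h12 := sitePos_ne hn (show k + 1 < k + 2 by omega) (by omega)
  unfold embed3
  rw [hGHZ_apply]
  generalize sitePos hn k = a at *
  generalize sitePos hn (k + 1) = b at *
  generalize sitePos hn (k + 2) = c at *
  by_cases hgf : g = f
  · subst hgf
    simp [(flipAt_ne g b).symm]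
  by_cases hgl : g = flipAt f b
  · subst hgl
    have hoff : ∀ j : Fin n, j ≠ a → j ≠ b → j ≠ c → f j = flipAt f b j :=
      fun j _ hj _ => (flipAt_of_ne f hj).symm
    rw [if_pos hoff]
    simp [hgf, flipAt_self, flipAt_of_ne f h01, flipAt_of_ne f h12.symm,
      (fin_two_sub_ne (f b)).symm]
  · rw [if_neg hgf, if_neg hgl]
    by_cases hoff : ∀ j : Fin n, j ≠ a → j ≠ b → j ≠ c → f j = g j
    · have : ¬ (f a = g a ∧ f c = g c) := by
        rintro ⟨ha, hc⟩
        have hoff' : ∀ j, j ≠ b → g j = f j := by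
          intro j hj
          by_cases hja : j = a
          · rw [hja, ha]
          by_cases hjc : j = c
          · rw [hjc, hc]
          exact (hoff j hja hj hjc).symm
        by_cases hb : g b = f b
        · exact hgf (funext fun j => by
            by_cases hj : j = b
            · rw [hj, hb]
            · exact hoff' j hj)
        · refine hgl (funext fun j => ?_)
          by_cases hj : j = b
          · rw [hj, flipAt_self]
            generalize g b = x at *
            generalize f b = y at *
            revert x y; decide
          · rw [flipAt_of_ne f hj, hoff' j hj]
      rw [if_neg this]; simp
    · rw [if_neg hoff]; simp

theorem embed3_hGHZ_mulVec {n : ℕ} (hn : 0 < n) (h3 : 3 ≤ n) (k : ℕ)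
    (v : (Fin n → Fin 2) → ℂ) (f : Fin n → Fin 2) :
    (embed3 hn hGHZ k).mulVec v f =
      if f (sitePos hn k) = f (sitePos hn (k + 2)) then
        (if f (sitePos hn (k + 1)) = f (sitePos hn k) then 0 else v f)
      else (v f - v (flipAt f (sitePos hn (k + 1)))) / 2 := by
  simp only [Matrix.mulVec, dotProduct, embed3_hGHZ_apply hn h3, add_mul, ite_mul, zero_mul,
    Finset.sum_add_distrib, Finset.sum_ite_eq', Finset.mem_univ, if_true]
  split_ifs <;> ring

theorem embed3_hGHZ_isHermitian {n : ℕ} (hn : 0 < n) (k : ℕ) :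
    (embed3 hn hGHZ k).IsHermitian := by
  have hG : ∀ x y, star (hGHZ y x) = hGHZ x y := by
    rintro ⟨x, y, z⟩ ⟨x', y', z'⟩
    rw [hGHZ_apply, hGHZ_apply]
    by_cases hxz : x = x' ∧ z = z'
    · obtain ⟨rfl, rfl⟩ := hxz
      by_cases hy : y = y'
      · subst hy
        split_ifs <;> simp
      · simp only [hy, Ne.symm hy, if_false, false_and]
        split_ifs <;> simp
    · rw [if_neg hxz, if_neg (fun h => hxz ⟨h.1.symm, h.2.symm⟩), star_zero]
  ext f g
  simp only [Matrix.conjTranspose_apply, embed3, star_mul', hG]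
  congr 1
  simp only [eq_comm (a := g _) (b := f _)]
  split_ifs <;> simp

theorem embed3_hGHZ_mul_self {n : ℕ} (hn : 0 < n) (h3 : 3 ≤ n) (k : ℕ) :
    embed3 hn hGHZ k * embed3 hn hGHZ k = embed3 hn hGHZ k := by
  have h01 := sitePos_ne hn (show k < k + 1 by omega) (by omega)
  have h12 := sitePos_ne hn (show k + 1 < k + 2 by omega) (by omega)
  refine Matrix.ext_of_mulVec_single fun g => ?_
  generalize (Pi.single g 1 : (Fin n → Fin 2) → ℂ) = v
  rw [← Matrix.mulVec_mulVec]
  ext f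
  simp only [embed3_hGHZ_mulVec hn h3, flipAt_flipAt, flipAt_of_ne f h01,
    flipAt_of_ne f h12.symm]
  split_ifs
  · rfl
  · rfl
  · ring

theorem embed3_hGHZ_posSemidef {n : ℕ} (hn : 0 < n) (h3 : 3 ≤ n) (k : ℕ) :
    (embed3 hn hGHZ k).PosSemidef := by
  have h := Matrix.posSemidef_conjTranspose_mul_self (embed3 hn hGHZ k)
  rwa [(embed3_hGHZ_isHermitian hn k).eq, embed3_hGHZ_mul_self hn h3] at h

theorem Huncle_posSemidef (N : ℕ) : (Huncle N).PosSemidef :=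
  Matrix.posSemidef_sum _ fun k _ =>
    embed3_hGHZ_posSemidef (show 0 < 2 * N + 3 by omega) (by omega) k

/-- The Hamiltonian is frustration free on its kernel. -/
theorem embed3_mulVec_eq_zero {N : ℕ} {v : (Fin (2 * N + 3) → Fin 2) → ℂ}
    (hv : (Huncle N).mulVec v = 0) {k : ℕ} (hk : k < 2 * N + 3) :
    (embed3 (show 0 < 2 * N + 3 by omega) hGHZ k).mulVec v = 0 := by
  have hps := fun k => embed3_hGHZ_posSemidef (show 0 < 2 * N + 3 by omega) (by omega) k
  have hsum : ∑ k ∈ Finset.range (2 * N + 3),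
      star v ⬝ᵥ (embed3 (show 0 < 2 * N + 3 by omega) hGHZ k).mulVec v = 0 := by
    rw [← dotProduct_sum, ← Matrix.sum_mulVec]
    change star v ⬝ᵥ (Huncle N).mulVec v = 0
    rw [hv, dotProduct_zero]
  rw [Finset.sum_eq_zero_iff_of_nonneg fun k _ => (hps k).dotProduct_mulVec_nonneg v] at hsum
  exact ((hps k).dotProduct_mulVec_zero_iff v).1 (hsum k (Finset.mem_range.2 hk))

theorem exists_pos_eigenvalue_lt {n : Type*} [Fintype n] [DecidableEq n]
    {A : Matrix n n ℂ} (hA : A.PosSemidef) {x : n → ℂ}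
    (hker : ∀ v, A.mulVec v = 0 → star v ⬝ᵥ x = 0) {C : ℝ}
    (hx : (star x ⬝ᵥ A.mulVec x).re < C * (star x ⬝ᵥ x).re) :
    ∃ lam : ℝ, 0 < lam ∧ lam < C ∧ Module.End.HasEigenvalue A.mulVecLin (lam : ℂ) := by
  have hH := hA.isHermitian
  set b := hH.eigenvectorBasis
  set ev := hH.eigenvalues
  have hb : ∀ m, A.mulVec (b m) = (ev m : ℂ) • (b m : n → ℂ) := by
    intro m
    have := hH.mulVec_eigenvectorBasis m
    rw [this]
    ext i
    simp [ev, b]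
  have hparseval : ∀ y : n → ℂ,
      star x ⬝ᵥ y = ∑ m, (star x ⬝ᵥ (b m : n → ℂ)) * (star (b m : n → ℂ) ⬝ᵥ y) := by
    intro y
    have := b.sum_inner_mul_inner (WithLp.toLp 2 x) (WithLp.toLp 2 y)
    simp only [EuclideanSpace.inner_eq_star_dotProduct] at this
    simp only [dotProduct_comm (star x), dotProduct_comm (star (b _ : n → ℂ))]
    exact this.symm
  have hstar : ∀ m, star x ⬝ᵥ (b m : n → ℂ) = star (star (b m : n → ℂ) ⬝ᵥ x) := by
    intro m
    rw [Matrix.star_dotProduct]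
  have hAx : ∀ m, star (b m : n → ℂ) ⬝ᵥ A.mulVec x =
      (ev m : ℂ) * (star (b m : n → ℂ) ⬝ᵥ x) := by
    intro m
    rw [Matrix.dotProduct_mulVec, ← hH.eq, ← Matrix.star_mulVec, hb]
    simp
  have hsq : ∀ z : ℂ, star z * z = ((‖z‖ ^ 2 : ℝ) : ℂ) := fun z => by
    simpa using Complex.conj_mul' z
  have h1 : (star x ⬝ᵥ x).re = ∑ m, ‖star (b m : n → ℂ) ⬝ᵥ x‖ ^ 2 := by
    rw [hparseval x]
    simp only [hstar, hsq, ← Complex.ofReal_sum, Complex.ofReal_re]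
  have h2 : (star x ⬝ᵥ A.mulVec x).re = ∑ m, ev m * ‖star (b m : n → ℂ) ⬝ᵥ x‖ ^ 2 := by
    rw [hparseval (A.mulVec x)]
    simp only [hstar, hAx, mul_left_comm _ (Complex.ofReal _), hsq, ← Complex.ofReal_mul,
      ← Complex.ofReal_sum, Complex.ofReal_re]
  rw [h1, h2, Finset.mul_sum] at hx
  obtain ⟨m, -, hm⟩ := Finset.exists_lt_of_sum_lt hx
  have hm0 : star (b m : n → ℂ) ⬝ᵥ x ≠ 0 := by
    intro h
    simp [h] at hm
  refine ⟨ev m, (hA.eigenvalues_nonneg m).lt_of_ne ?_, lt_of_mul_lt_mul_right hm (by positivity),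
    Module.End.hasEigenvalue_of_hasEigenvector (x := (b m : n → ℂ))
      (Module.End.hasEigenvector_iff.2 ⟨Module.End.mem_eigenspace_iff.2 (hb m), ?_⟩)⟩
  · intro h
    refine hm0 (hker _ ?_)
    rw [hb m, show ev m = 0 from h.symm]
    simp
  · intro h
    rw [h] at hm0
    simp at hm0

end

theorem flipAt_wallConfig {N : ℕ} {i j i' j' : ℤ} {p : Fin (2 * N + 3)}
    (hp : (i ≤ (p : ℤ) - (N + 1) ∧ (p : ℤ) - (N + 1) ≤ j) ↔
      ¬ (i' ≤ (p : ℤ) - (N + 1) ∧ (p : ℤ) - (N + 1) ≤ j'))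
    (hq : ∀ q : ℕ, q ≠ p → ((i ≤ (q : ℤ) - (N + 1) ∧ (q : ℤ) - (N + 1) ≤ j) ↔
      (i' ≤ (q : ℤ) - (N + 1) ∧ (q : ℤ) - (N + 1) ≤ j'))) :
    flipAt (wallConfig N i j) p = wallConfig N i' j' := by
  funext q
  by_cases h : q = p
  · subst h
    rw [flipAt_self]
    unfold wallConfig
    simp only [hp]
    by_cases h' : i' ≤ (q : ℤ) - (N + 1) ∧ (q : ℤ) - (N + 1) ≤ j'
    · rw [if_neg (not_not.2 h'), if_pos h']; rfl
    · rw [if_pos h', if_neg h']; rfl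
  · rw [flipAt_of_ne _ h]
    unfold wallConfig
    simp only [hq q (fun e => h (Fin.ext e))]

theorem wallConfig_eq_iff (N : ℕ) (i j i' j' : ℤ) (p q : Fin (2 * N + 3)) :
    wallConfig N i j p = wallConfig N i' j' q ↔
      ((i ≤ (p : ℤ) - (N + 1) ∧ (p : ℤ) - (N + 1) ≤ j) ↔
        (i' ≤ (q : ℤ) - (N + 1) ∧ (q : ℤ) - (N + 1) ≤ j')) := by
  unfold wallConfig
  split_ifs with h1 h2 h2
  · exact iff_of_true rfl (iff_of_true h1 h2)
  · exact iff_of_false (by decide) fun h => h2 (h.1 h1)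
  · exact iff_of_false (by decide) fun h => h1 (h.2 h2)
  · exact iff_of_true rfl (iff_of_false h1 h2)

theorem wallConfig_injective {N : ℕ} {i j i' j' : ℤ}
    (hi : i ∈ Finset.Icc (-(N : ℤ)) (-1)) (hj : j ∈ Finset.Icc (1 : ℤ) N)
    (hi' : i' ∈ Finset.Icc (-(N : ℤ)) (-1)) (hj' : j' ∈ Finset.Icc (1 : ℤ) N)
    (h : wallConfig N i j = wallConfig N i' j') : i = i' ∧ j = j' := by
  rw [Finset.mem_Icc] at *
  have key : ∀ s : ℤ, -(N + 1) ≤ s → s ≤ N + 1 → ((i ≤ s ∧ s ≤ j) ↔ (i' ≤ s ∧ s ≤ j')) := by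
    intro s h1 h2
    have := (wallConfig_eq_iff N i j i' j' ⟨(s + (N + 1)).toNat, by omega⟩ _).1 (congrFun h _)
    have e : ((s + (N + 1)).toNat : ℤ) - (N + 1) = s := by omega
    simpa only [e] using this
  have a1 := key i (by omega) (by omega)
  have a2 := key i' (by omega) (by omega)
  have a3 := key j (by omega) (by omega)
  have a4 := key j' (by omega) (by omega)
  omega

theorem phiN_apply (N : ℕ) (f : Fin (2 * N + 3) → Fin 2) :
    phiN N f = ∑ i ∈ Finset.Icc (-(N : ℤ)) (-1), ∑ j ∈ Finset.Icc (1 : ℤ) (N : ℤ),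
      if f = wallConfig N i j then 1 else 0 := by
  simp [phiN, basisState, Finset.sum_apply]

theorem phiN_wallConfig {N : ℕ} {i j : ℤ} (hi : i ∈ Finset.Icc (-(N : ℤ)) (-1))
    (hj : j ∈ Finset.Icc (1 : ℤ) N) : phiN N (wallConfig N i j) = 1 := by
  rw [phiN_apply, Finset.sum_eq_single_of_mem i hi, Finset.sum_eq_single_of_mem j hj, if_pos rfl]
  · intro j' hj' hne
    exact if_neg fun h => hne (wallConfig_injective hi hj hi hj' h).2.symm
  · intro i' hi' hne
    exact Finset.sum_eq_zero fun j' hj' =>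
      if_neg fun h => hne (wallConfig_injective hi hj hi' hj' h).1.symm

theorem phiN_re_nonneg (N : ℕ) (f : Fin (2 * N + 3) → Fin 2) : 0 ≤ (phiN N f).re := by
  rw [phiN_apply]
  simp only [Complex.re_sum]
  refine Finset.sum_nonneg fun i _ => Finset.sum_nonneg fun j _ => ?_
  split_ifs <;> simp

theorem star_basisState_dotProduct {n : ℕ} (c : Fin n → Fin 2) (v : (Fin n → Fin 2) → ℂ) :
    star (basisState c) ⬝ᵥ v = v c := by
  simp [dotProduct, basisState, apply_ite, ite_mul]

theorem star_phiN_dotProduct (N : ℕ) (v : (Fin (2 * N + 3) → Fin 2) → ℂ) :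
    star (phiN N) ⬝ᵥ v = ∑ i ∈ Finset.Icc (-(N : ℤ)) (-1), ∑ j ∈ Finset.Icc (1 : ℤ) (N : ℤ),
      v (wallConfig N i j) := by
  simp only [phiN, star_sum, sum_dotProduct, star_basisState_dotProduct]

theorem star_phiN_dotProduct_self (N : ℕ) : star (phiN N) ⬝ᵥ phiN N = (N : ℂ) ^ 2 := by
  rw [star_phiN_dotProduct, Finset.sum_congr rfl fun i hi => Finset.sum_congr rfl fun j hj =>
    phiN_wallConfig hi hj]
  simp [sq]

theorem phiN_const (N : ℕ) (x : Fin 2) : phiN N (fun _ => x) = 0 := by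
  rw [phiN_apply]
  refine Finset.sum_eq_zero fun i hi => Finset.sum_eq_zero fun j hj => if_neg fun h => ?_
  rw [Finset.mem_Icc] at hi hj
  have h' := (congrFun h ⟨0, by omega⟩).symm.trans (congrFun h ⟨N + 1, by omega⟩)
  rw [wallConfig_eq_iff] at h'
  push_cast at h'
  omega

theorem kernel_wallConfig {N : ℕ} {v : (Fin (2 * N + 3) → Fin 2) → ℂ}
    (hv : (Huncle N).mulVec v = 0) (d : ℕ) (i j : ℤ) (hd : j = i + d) (hi : -(N : ℤ) ≤ i)
    (hj : j ≤ N) : v (wallConfig N i j) = 0 := by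
  have hpos : 0 < 2 * N + 3 := by omega
  obtain ⟨k, hk⟩ : ∃ k : ℕ, (k : ℤ) = i + N := ⟨(i + N).toNat, by omega⟩
  have ha : (sitePos hpos k : ℕ) = k := Nat.mod_eq_of_lt (by omega)
  have hb : (sitePos hpos (k + 1) : ℕ) = k + 1 := Nat.mod_eq_of_lt (by omega)
  have hc : (sitePos hpos (k + 2) : ℕ) = k + 2 := Nat.mod_eq_of_lt (by omega)
  have h := congrFun (embed3_mulVec_eq_zero hv (show k < 2 * N + 3 by omega))
    (wallConfig N i j)
  rw [embed3_hGHZ_mulVec hpos (by omega)] at h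
  simp only [wallConfig_eq_iff, ha, hb, hc, Pi.zero_apply] at h
  cases d with
  | zero =>
    rwa [if_pos (by push_cast; omega), if_neg (by push_cast; omega)] at h
  | succ d =>
    have ih := kernel_wallConfig hv d (i + 1) j (by omega) (by omega) hj
    rw [if_neg (by push_cast; omega), flipAt_wallConfig (i' := i + 1) (j' := j)
      (by rw [hb]; omega) (fun q hq => by rw [hb] at hq; omega), ih] at h
    simpa using h

theorem sitePos_val_add {n : ℕ} (hn : 0 < n) {k m : ℕ} (hk : k < n) (hm : m ≤ n) :
    (k + m < n ∧ (sitePos hn (k + m) : ℕ) = k + m) ∨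
      (n ≤ k + m ∧ (sitePos hn (k + m) : ℕ) + n = k + m) := by
  rcases lt_or_ge (k + m) n with h | h
  · exact Or.inl ⟨h, Nat.mod_eq_of_lt h⟩
  · refine Or.inr ⟨h, ?_⟩
    change (k + m) % n + n = k + m
    rw [Nat.mod_eq_sub_mod h, Nat.mod_eq_of_lt (by omega)]
    omega

theorem embed3_mulVec_phiN_re_le {N k : ℕ} (hk : k < 2 * N + 3) {i j : ℤ}
    (hi : i ∈ Finset.Icc (-(N : ℤ)) (-1)) (hj : j ∈ Finset.Icc (1 : ℤ) N) :
    ((embed3 (show 0 < 2 * N + 3 by omega) hGHZ k).mulVec (phiN N) (wallConfig N i j)).re ≤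
      ((if k = 2 * N + 2 then (if i = -(N : ℤ) then 1 else 0) else 0) +
        (if k = N - 1 then (if i = -1 then 1 else 0) else 0) +
        (if k = N + 1 then (if j = 1 then 1 else 0) else 0) +
        (if k = 2 * N + 1 then (if j = (N : ℤ) then 1 else 0) else 0)) / 2 := by
  have hpos : 0 < 2 * N + 3 := by omega
  have ha : (sitePos hpos k : ℕ) = k := Nat.mod_eq_of_lt hk
  have hb := sitePos_val_add hpos hk (show 1 ≤ 2 * N + 3 by omega)
  have hc := sitePos_val_add hpos hk (show 2 ≤ 2 * N + 3 by omega)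
  have hi' := Finset.mem_Icc.1 hi
  have hj' := Finset.mem_Icc.1 hj
  rw [embed3_hGHZ_mulVec hpos (by omega)]
  simp only [wallConfig_eq_iff, ha]
  generalize sitePos hpos (k + 1) = b at *
  generalize sitePos hpos (k + 2) = c at *
  have hnonneg : ∀ (P Q : Prop) [Decidable P] [Decidable Q],
      (0 : ℝ) ≤ if P then (if Q then 1 else 0) else 0 := by
    intro P Q _ _
    split_ifs <;> simp
  have hbulk : ∀ i' j' : ℤ, i' ∈ Finset.Icc (-(N : ℤ)) (-1) → j' ∈ Finset.Icc (1 : ℤ) N →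
      flipAt (wallConfig N i j) b = wallConfig N i' j' →
      ((phiN N (wallConfig N i j) - phiN N (flipAt (wallConfig N i j) b)) / 2).re = 0 := by
    intro i' j' hi' hj' h
    rw [h, phiN_wallConfig hi hj, phiN_wallConfig hi' hj']
    simp
  have hedge : ((phiN N (wallConfig N i j) - phiN N (flipAt (wallConfig N i j) b)) / 2).re ≤
      1 / 2 := by
    have := phiN_re_nonneg N (flipAt (wallConfig N i j) b)
    rw [phiN_wallConfig hi hj, Complex.div_ofNat_re, Complex.sub_re, Complex.one_re]
    linarith
  have n1 := hnonneg (k = 2 * N + 2) (i = -(N : ℤ))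
  have n2 := hnonneg (k = N - 1) (i = -1)
  have n3 := hnonneg (k = N + 1) (j = 1)
  have n4 := hnonneg (k = 2 * N + 1) (j = (N : ℤ))
  by_cases hac : (i ≤ (k : ℤ) - (N + 1) ∧ (k : ℤ) - (N + 1) ≤ j) ↔
      (i ≤ (c : ℤ) - (N + 1) ∧ (c : ℤ) - (N + 1) ≤ j)
  · rw [if_pos hac, if_pos (by omega), Complex.zero_re]
    linarith
  rw [if_neg hac]
  by_cases e1 : k = 2 * N + 2 ∧ i = -(N : ℤ)
  · rw [if_pos e1.1, if_pos e1.2]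
    linarith
  by_cases e2 : k = N - 1 ∧ i = -1
  · rw [if_pos e2.1, if_pos e2.2] at *
    linarith
  by_cases e3 : k = N + 1 ∧ j = 1
  · rw [if_pos e3.1, if_pos e3.2] at *
    linarith
  by_cases e4 : k = 2 * N + 1 ∧ j = (N : ℤ)
  · rw [if_pos e4.1, if_pos e4.2] at *
    linarith
  refine le_trans (le_of_eq ?_) (show (0 : ℝ) ≤ _ by linarith)
  have hs : (b : ℤ) - (N + 1) = i - 1 ∨ (b : ℤ) - (N + 1) = i ∨ (b : ℤ) - (N + 1) = j ∨
      (b : ℤ) - (N + 1) = j + 1 := by omega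
  rcases hs with hs | hs | hs | hs
  · exact hbulk (i - 1) j (Finset.mem_Icc.2 (by omega)) hj
      (flipAt_wallConfig (by omega) fun q hq => by omega)
  · exact hbulk (i + 1) j (Finset.mem_Icc.2 (by omega)) hj
      (flipAt_wallConfig (by omega) fun q hq => by omega)
  · exact hbulk i (j - 1) hi (Finset.mem_Icc.2 (by omega))
      (flipAt_wallConfig (by omega) fun q hq => by omega)
  · exact hbulk i (j + 1) hi (Finset.mem_Icc.2 (by omega))
      (flipAt_wallConfig (by omega) fun q hq => by omega)

theorem phiN_energy_le (N : ℕ) :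
    (star (phiN N) ⬝ᵥ (Huncle N).mulVec (phiN N)).re ≤ 2 * N := by
  rcases Nat.eq_zero_or_pos N with rfl | hN
  · simp [star_phiN_dotProduct]
  simp only [star_phiN_dotProduct, Complex.re_sum, Huncle, Matrix.sum_mulVec, Finset.sum_apply]
  refine (Finset.sum_le_sum fun i hi => Finset.sum_le_sum fun j hj => Finset.sum_le_sum fun k hk =>
    embed3_mulVec_phiN_re_le (Finset.mem_range.1 hk) hi hj).trans (le_of_eq ?_)
  have h1 : N - 1 < 2 * N + 3 := by omega
  have h2 : N + 1 < 2 * N + 3 := by omega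
  have h3 : (1 : ℤ) ≤ N := by omega
  simp only [← Finset.sum_div, Finset.sum_add_distrib, Finset.sum_ite_eq', Finset.mem_range,
    Finset.sum_const]
  simp [h1, h2, h3]
  ring

/-- For the GHZ uncle `H'` on a periodic chain of `2N+3` qubits, the state
`|φ_N⟩` satisfies `⟨φ_N|φ_N⟩ = N²`, is orthogonal to `|0⋯0⟩` and `|1⋯1⟩`, and has energy
`⟨φ_N|H'|φ_N⟩ ≤ C·N` for a constant `C` independent of `N`; consequently `H'` has a nonzero
eigenvalue `λ_N ≤ C/N`. -/
theorem stmt_15 :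
    ∃ C : ℝ, 0 < C ∧ ∀ N : ℕ, 1 ≤ N →
      star (phiN N) ⬝ᵥ phiN N = (N : ℂ) ^ 2 ∧
      star (basisState (fun _ => (0 : Fin 2))) ⬝ᵥ phiN N = 0 ∧
      star (basisState (fun _ => (1 : Fin 2))) ⬝ᵥ phiN N = 0 ∧
      (star (phiN N) ⬝ᵥ (Huncle N).mulVec (phiN N)).re ≤ C * N ∧
      ∃ lam : ℝ, 0 < lam ∧ lam ≤ C / N ∧
        Module.End.HasEigenvalue (Huncle N).mulVecLin (lam : ℂ) := by
  refine ⟨3, by norm_num, fun N hN => ⟨star_phiN_dotProduct_self N, ?_, ?_, ?_, ?_⟩⟩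
  · rw [star_basisState_dotProduct, phiN_const]
  · rw [star_basisState_dotProduct, phiN_const]
  · exact (phiN_energy_le N).trans (by gcongr; norm_num)
  have hN' : (0 : ℝ) < N := by exact_mod_cast hN
  have hker : ∀ v, (Huncle N).mulVec v = 0 → star v ⬝ᵥ phiN N = 0 := by
    intro v hv
    rw [Matrix.star_dotProduct, star_phiN_dotProduct, star_eq_zero]
    refine Finset.sum_eq_zero fun i hi => Finset.sum_eq_zero fun j hj => ?_
    rw [Finset.mem_Icc] at hi hj
    exact kernel_wallConfig hv (j - i).toNat i j (by omega) (by omega) (by omega)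
  have henergy : (star (phiN N) ⬝ᵥ (Huncle N).mulVec (phiN N)).re <
      3 / N * (star (phiN N) ⬝ᵥ phiN N).re := by
    refine (phiN_energy_le N).trans_lt ?_
    rw [star_phiN_dotProduct_self, ← Complex.ofReal_natCast, ← Complex.ofReal_pow,
      Complex.ofReal_re]
    field_simp
    norm_num
  obtain ⟨lam, h0, hlt, hlam⟩ := exists_pos_eigenvalue_lt (Huncle_posSemidef N) hker henergy
  exact ⟨lam, h0, hlt.le, hlam⟩

end
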